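/- arXiv:1402.3965 — 7 statements merged into one kernel-verified Lean document; each statement's English description precedes it below -/
import Mathlib

section
/- Let 0 < α < 1 and let t, r > 0 be real numbers. Then ∫₀ᵗ s^(α−1) · (t − s + r)^(−1−α) ds = t^α · r^(−α) / (α · (t + r)). -/
open Real MeasureTheory

/-- An antiderivative of `s ^ (α - 1) * (t - s + r) ^ (-1 - α)`. -/
theorem hasDerivAt_rpow_mul_sub_rpow_neg {α t r s : ℝ} (hα : α ≠ 0) (hs : 0 < s)
    (hsr : 0 < t - s + r) :
    HasDerivAt (fun x : ℝ => x ^ α * (t - x + r) ^ (-α) / (α * (t + r)))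
      (s ^ (α - 1) * (t - s + r) ^ (-1 - α)) s := by
  have h₁ : HasDerivAt (fun x : ℝ => x ^ α) (α * s ^ (α - 1)) s :=
    Real.hasDerivAt_rpow_const (Or.inl hs.ne')
  have h₂ : HasDerivAt (fun x : ℝ => (t - x + r) ^ (-α)) (-1 * -α * (t - s + r) ^ (-α - 1)) s :=
    (((hasDerivAt_id s).const_sub t).add_const r).rpow_const (Or.inl hsr.ne')
  convert! (h₁.mul h₂).div_const (α * (t + r)) using 1
  have e₁ : s ^ α = s ^ (α - 1) * s := by
    rw [← Real.rpow_add_one hs.ne', sub_add_cancel]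
  have e₂ : (t - s + r) ^ (-α) = (t - s + r) ^ (-1 - α) * (t - s + r) := by
    rw [← Real.rpow_add_one hsr.ne']
    ring_nf
  have e₃ : -α - 1 = -1 - α := by ring
  have htr : t + r ≠ 0 := by linarith
  rw [e₁, e₂, e₃]
  field_simp
  ring

/-- Key integral identity (Lemma in the proof of Theorem 3.1):
for `0 < α < 1` and `t, r > 0`,
`∫₀ᵗ s^(α−1) (t − s + r)^(−1−α) ds = t^α r^(−α) / (α (t + r))`. -/
theorem stmt_0 (α t r : ℝ) (hα0 : 0 < α) (hα1 : α < 1) (ht : 0 < t) (hr : 0 < r) :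
    ∫ s in (0:ℝ)..t, s ^ (α - 1) * (t - s + r) ^ (-1 - α)
      = t ^ α * r ^ (-α) / (α * (t + r)) := by
  have hcont : ContinuousOn (fun x : ℝ => x ^ α * (t - x + r) ^ (-α) / (α * (t + r)))
      (Set.Icc 0 t) := by
    refine ContinuousOn.div_const (ContinuousOn.mul ?_ ?_) _
    · exact (Real.continuous_rpow_const hα0.le).continuousOn
    · refine ContinuousOn.rpow_const (by fun_prop) fun x hx => Or.inl ?_
      linarith [hx.2]
  have hderiv (s : ℝ) (hs : s ∈ Set.Ioo 0 t) :=
    hasDerivAt_rpow_mul_sub_rpow_neg (t := t) (r := r) hα0.ne' hs.1 (by linarith [hs.2])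
  have hint : IntervalIntegrable (fun s : ℝ => s ^ (α - 1) * (t - s + r) ^ (-1 - α))
      volume 0 t := by
    rw [intervalIntegrable_iff_integrableOn_Ioc_of_le ht.le]
    refine intervalIntegral.integrableOn_deriv_of_nonneg hcont hderiv fun s hs => ?_
    exact mul_nonneg (Real.rpow_nonneg hs.1.le _)
      (Real.rpow_nonneg (by linarith [hs.2]) _)
  rw [intervalIntegral.integral_eq_sub_of_hasDerivAt_of_le ht.le hcont hderiv hint]
  simp [Real.zero_rpow hα0.ne']
end

section
/- Let 0 < α < 1, let t₀ > 0 and t₁ > 0, and let f : ℝ → ℝ be integrable on [0, t₁]. Then ∫₀^{t₁} ∫₀^{t₀} (s^(α−1) / Γ(α)) · f(r) · (α / Γ(1−α)) · (r − s + t₀)^(−1−α) ds dr = ∫₀^{t₁} f(r) · p_{t₀}(r) dr, where p_{t₀}(r) = (r/t₀)^(−α) · (1 + r/t₀)^(−1) / (t₀ · B(α, 1−α)). -/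
open Real MeasureTheory

/-- The Beta function `B(a,b) = Γ(a)Γ(b)/Γ(a+b)`. -/
noncomputable def betaFn (a b : ℝ) : ℝ := Real.Gamma a * Real.Gamma b / Real.Gamma (a + b)

/-- The generalized beta prime density `GB2(1−α, α, h)`:
`p_h(r) = (r/h)^(−α) (1 + r/h)^(−1) / (h B(α, 1−α))`. -/
noncomputable def gb2 (α h r : ℝ) : ℝ :=
  (r / h) ^ (-α) * (1 + r / h) ^ (-1 : ℝ) / (h * betaFn α (1 - α))

/-- An incomplete beta integral whose exponents sum to `-2`, with antiderivative
`s ^ a * (c - s) ^ (-a) / (a * c)`. -/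
theorem integral_rpow_mul_sub_rpow {a b c : ℝ} (ha : 0 < a) (hb : 0 < b) (hbc : b < c) :
    ∫ s in (0:ℝ)..b, s ^ (a - 1) * (c - s) ^ (-1 - a)
      = b ^ a * (c - b) ^ (-a) / (a * c) := by
  have hc : 0 < c := hb.trans hbc
  have hpos : ∀ s ∈ Set.Icc 0 b, 0 < c - s := fun s hs => by linarith [hs.2]
  have hcont : ContinuousOn (fun s : ℝ => s ^ a * (c - s) ^ (-a) / (a * c)) (Set.Icc 0 b) := by
    refine ContinuousOn.div_const (ContinuousOn.mul ?_ ?_) _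
    · exact (continuous_id.rpow_const fun _ => Or.inr ha.le).continuousOn
    · exact (continuousOn_const.sub continuousOn_id).rpow_const
        fun s hs => Or.inl (hpos s hs).ne'
  have hderiv : ∀ s ∈ Set.Ioo 0 b, HasDerivAt (fun s : ℝ => s ^ a * (c - s) ^ (-a) / (a * c))
      (s ^ (a - 1) * (c - s) ^ (-1 - a)) s := by
    intro s hs
    have hcs : 0 < c - s := hpos s ⟨hs.1.le, hs.2.le⟩
    have h1 : HasDerivAt (fun s : ℝ => s ^ a) (a * s ^ (a - 1)) s :=
      hasDerivAt_rpow_const (Or.inl hs.1.ne')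
    have h2 := ((hasDerivAt_id s).const_sub c).rpow_const (p := -a) (Or.inl hcs.ne')
    refine ((h1.mul h2).div_const (a * c)).congr_deriv ?_
    have e1 : s ^ a = s ^ (a - 1) * s := by
      rw [← rpow_add_one hs.1.ne', sub_add_cancel]
    have e2 : (c - s) ^ (-a) = (c - s) ^ (-1 - a) * (c - s) := by
      rw [← rpow_add_one hcs.ne']
      ring_nf
    simp only [id_eq]
    rw [show -a - 1 = -1 - a by ring, e1, e2]
    field_simp
    ring
  have hint : IntervalIntegrable (fun s : ℝ => s ^ (a - 1) * (c - s) ^ (-1 - a)) volume 0 b := by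
    refine (intervalIntegral.intervalIntegrable_rpow' (by linarith)).mul_continuousOn ?_
    rw [Set.uIcc_of_le hb.le]
    exact (continuousOn_const.sub continuousOn_id).rpow_const fun s hs => Or.inl (hpos s hs).ne'
  rw [intervalIntegral.integral_eq_sub_of_hasDerivAt_of_le hb.le hcont hderiv hint,
    zero_rpow ha.ne']
  simp

/-- The analytic core of Theorem 3.1: convolving the potential density `s^(α−1)/Γ(α)` of a
stable subordinator with its Lévy jump tail produces the generalized beta prime kernel. -/
theorem stmt_1 (α t₀ t₁ : ℝ) (hα0 : 0 < α) (hα1 : α < 1) (ht₀ : 0 < t₀) (ht₁ : 0 < t₁)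
    (f : ℝ → ℝ) (hf : IntegrableOn f (Set.Icc 0 t₁)) :
    (∫ r in (0:ℝ)..t₁, ∫ s in (0:ℝ)..t₀,
        (s ^ (α - 1) / Real.Gamma α) * f r * (α / Real.Gamma (1 - α)) * (r - s + t₀) ^ (-1 - α))
      = ∫ r in (0:ℝ)..t₁, f r * gb2 α t₀ r := by
  refine intervalIntegral.integral_congr_ae (Filter.Eventually.of_forall fun r hr => ?_)
  rw [Set.uIoc_of_le ht₁.le] at hr
  have hr0 : 0 < r := hr.1
  have hs : ∀ s : ℝ, (s ^ (α - 1) / Real.Gamma α) * f r * (α / Real.Gamma (1 - α))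
        * (r - s + t₀) ^ (-1 - α)
      = (f r * α / (Real.Gamma α * Real.Gamma (1 - α)))
        * (s ^ (α - 1) * (r + t₀ - s) ^ (-1 - α)) := by
    intro s
    rw [show r - s + t₀ = r + t₀ - s by ring]
    field_simp
  simp only [hs]
  rw [intervalIntegral.integral_const_mul,
    integral_rpow_mul_sub_rpow hα0 ht₀ (show t₀ < r + t₀ by linarith), add_sub_cancel_right,
    gb2, betaFn, add_sub_cancel, Real.Gamma_one, div_one, div_rpow hr0.le ht₀.le,
    rpow_neg_one, rpow_neg ht₀.le]
  have h1 := (Real.Gamma_pos_of_pos hα0).ne'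
  have h2 := (Real.Gamma_pos_of_pos (sub_pos.2 hα1)).ne'
  have h3 : r + t₀ ≠ 0 := by positivity
  have h4 : 1 + r / t₀ = (r + t₀) / t₀ := by field_simp; ring
  have h5 : t₀ ^ α ≠ 0 := by positivity
  rw [h4]
  field_simp
end

section
/- Let 0 < α < 1 and t > 0, and let f : ℝ → ℝ be a bounded measurable nonnegative function. Then lim_{t₀→∞} t₀^(1−α) · ∫₀ᵗ f(t − r) · p_{t₀}(r) dr = (sin(πα)/π) · ∫₀ᵗ f(t − r) · r^(−α) dr. In particular, if ∫₀ᵗ f(t−r) r^(−α) dr ≠ 0, then ∫₀ᵗ f(t−r) p_{t₀}(r) dr is asymptotically equivalent to C · t₀^(α−1) as t₀ → ∞, with C = (sin(πα)/π) ∫₀ᵗ f(t−r) r^(−α) dr. -/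
open Real MeasureTheory Filter

theorem betaFn_one_sub (α : ℝ) : betaFn α (1 - α) = π / Real.sin (π * α) := by
  simp [betaFn, Real.Gamma_mul_Gamma_one_sub]

theorem rpow_mul_gb2 (α : ℝ) {h r : ℝ} (hh : 0 < h) (hr : 0 ≤ r) :
    h ^ (1 - α) * gb2 α h r = Real.sin (π * α) / π * r ^ (-α) * (1 + r / h)⁻¹ := by
  have hpow : h ^ (-α) ≠ 0 := (rpow_pos_of_pos hh _).ne'
  have hsplit : h ^ (1 - α) = h * h ^ (-α) := by
    rw [sub_eq_add_neg, rpow_add hh, rpow_one]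
  rw [gb2, betaFn_one_sub, hsplit, div_rpow hr hh.le, rpow_neg_one,
    ← inv_div (Real.sin _)]
  generalize Real.sin (π * α) / π = c, (1 + r / h)⁻¹ = w
  field_simp

theorem tendsto_one_add_div_inv (r : ℝ) :
    Tendsto (fun h : ℝ => (1 + r / h)⁻¹) atTop (nhds 1) := by
  simpa using ((tendsto_const_nhds (x := r)).div_atTop tendsto_id).const_add 1 |>.inv₀ (by simp)

theorem tendsto_rpow_mul_integral_gb2 {α t : ℝ} (hα1 : α < 1) (ht : 0 ≤ t)
    {g : ℝ → ℝ} (hg : Measurable g) {M : ℝ} (hM : ∀ x, |g x| ≤ M) :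
    Tendsto (fun h : ℝ => h ^ (1 - α) * ∫ r in (0 : ℝ)..t, g r * gb2 α h r) atTop
      (nhds (Real.sin (π * α) / π * ∫ r in (0 : ℝ)..t, g r * r ^ (-α))) := by
  simp_rw [← intervalIntegral.integral_const_mul]
  refine intervalIntegral.tendsto_integral_filter_of_dominated_convergence
    (fun r => M * |Real.sin (π * α) / π| * r ^ (-α)) ?_ ?_ ?_ ?_
  · refine Eventually.of_forall fun h => Measurable.aestronglyMeasurable ?_
    unfold gb2
    fun_prop
  · filter_upwards [eventually_gt_atTop 0] with h hh
    refine Eventually.of_forall fun r hr => ?_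
    rw [Set.uIoc_of_le ht] at hr
    have hr0 := hr.1.le
    have hM0 : 0 ≤ M := (abs_nonneg _).trans (hM r)
    have hpow : 0 ≤ r ^ (-α) := rpow_nonneg hr0 _
    have hinv : (1 + r / h)⁻¹ ≤ 1 := inv_le_one_of_one_le₀ (by simp; positivity)
    have hinv0 : 0 ≤ (1 + r / h)⁻¹ := by positivity
    rw [mul_left_comm, rpow_mul_gb2 α hh hr0, norm_eq_abs, abs_mul, abs_mul, abs_mul,
      abs_of_nonneg hpow, abs_of_nonneg hinv0, mul_assoc M]
    exact mul_le_mul (hM r) (mul_le_of_le_one_right (by positivity) hinv) (by positivity) hM0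
  · exact (intervalIntegral.intervalIntegrable_rpow' (by linarith)).const_mul _
  · refine Eventually.of_forall fun r hr => ?_
    rw [Set.uIoc_of_le ht] at hr
    have hlim := (tendsto_one_add_div_inv r).const_mul
      (Real.sin (π * α) / π * (g r * r ^ (-α)))
    rw [mul_one] at hlim
    refine hlim.congr' ?_
    filter_upwards [eventually_gt_atTop 0] with h hh
    rw [mul_left_comm (h ^ _), rpow_mul_gb2 α hh hr.1.le]
    ring

theorem isEquivalent_of_tendsto_rpow_mul {u : ℝ → ℝ} {α c : ℝ} (hc : c ≠ 0)
    (hu : Tendsto (fun h : ℝ => h ^ (1 - α) * u h) atTop (nhds c)) :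
    Asymptotics.IsEquivalent atTop u (fun h => c * h ^ (α - 1)) := by
  have hne : ∀ᶠ h : ℝ in atTop, c * h ^ (α - 1) ≠ 0 := by
    filter_upwards [eventually_gt_atTop 0] with h hh
    exact mul_ne_zero hc (rpow_pos_of_pos hh _).ne'
  rw [Asymptotics.isEquivalent_iff_tendsto_one hne]
  have hlim := hu.div_const c
  rw [div_self hc] at hlim
  refine hlim.congr' ?_
  filter_upwards [eventually_gt_atTop 0] with h hh
  rw [Pi.div_apply, ← neg_sub 1 α, rpow_neg hh.le]
  have hpow : h ^ (1 - α) ≠ 0 := (rpow_pos_of_pos hh _).ne'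
  field_simp

/-- Corollary 5.1 (asymptotic behavior as the aging time `t₀ → ∞`):
`t₀^(1−α) ∫₀ᵗ f(t−r) p_{t₀}(r) dr → (sin(πα)/π) ∫₀ᵗ f(t−r) r^(−α) dr`, and in particular,
if the latter integral is nonzero, `∫₀ᵗ f(t−r) p_{t₀}(r) dr ∼ C t₀^(α−1)` as `t₀ → ∞`. -/
theorem stmt_5 (α t : ℝ) (hα0 : 0 < α) (hα1 : α < 1) (ht : 0 < t)
    (f : ℝ → ℝ) (hmeas : Measurable f) (hnonneg : ∀ x, 0 ≤ f x) (M : ℝ) (hbdd : ∀ x, f x ≤ M) :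
    Tendsto (fun t₀ : ℝ => t₀ ^ (1 - α) * ∫ r in (0:ℝ)..t, f (t - r) * gb2 α t₀ r)
        atTop (nhds ((Real.sin (Real.pi * α) / Real.pi) * ∫ r in (0:ℝ)..t, f (t - r) * r ^ (-α)))
      ∧ ((∫ r in (0:ℝ)..t, f (t - r) * r ^ (-α)) ≠ 0 →
          Asymptotics.IsEquivalent atTop
            (fun t₀ : ℝ => ∫ r in (0:ℝ)..t, f (t - r) * gb2 α t₀ r)
            (fun t₀ : ℝ =>
              ((Real.sin (Real.pi * α) / Real.pi) * ∫ r in (0:ℝ)..t, f (t - r) * r ^ (-α))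
                * t₀ ^ (α - 1))) := by
  have hlim := tendsto_rpow_mul_integral_gb2 (g := fun r => f (t - r)) hα1 ht.le
    (hmeas.comp (measurable_const.sub measurable_id))
    fun r => (abs_of_nonneg (hnonneg _)).trans_le (hbdd _)
  have hsin : 0 < Real.sin (π * α) :=
    sin_pos_of_pos_of_lt_pi (by positivity) (mul_lt_of_lt_one_right pi_pos hα1)
  exact ⟨hlim, fun hI => isEquivalent_of_tendsto_rpow_mul
    (mul_ne_zero (div_pos hsin pi_pos).ne' hI) hlim⟩
end

section
/- Let 0 < α < 1, and let g : ℝ → ℝ be a continuous nonnegative function such that for every t > 0 one has ∫₀^∞ (t/α) · y^(−1−1/α) · g(t · y^(−1/α)) dy = 1. Then for every bounded measurable function φ : ℝ → ℝ, the function t ↦ ∫₀^∞ φ(y) · (t/α) · y^(−1−1/α) · g(t · y^(−1/α)) dy is continuous on (0, ∞). -/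
open Real MeasureTheory Filter Set
open scoped Topology

/-- **Scheffé's lemma**: if nonnegative integrable functions converge almost everywhere to an
integrable function and their integrals converge, then they converge in `L¹`. -/
theorem tendsto_integral_abs_sub_of_tendsto_integral {ι X : Type*} [MeasurableSpace X]
    {μ : Measure X} {l : Filter ι} [l.IsCountablyGenerated] {F : ι → X → ℝ} {f : X → ℝ}
    (hF : ∀ᶠ i in l, Integrable (F i) μ) (hF_nonneg : ∀ᶠ i in l, 0 ≤ᵐ[μ] F i)
    (hf : Integrable f μ) (hf_nonneg : 0 ≤ᵐ[μ] f)
    (hlim : ∀ᵐ x ∂μ, Tendsto (fun i => F i x) l (𝓝 (f x)))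
    (hint : Tendsto (fun i => ∫ x, F i x ∂μ) l (𝓝 (∫ x, f x ∂μ))) :
    Tendsto (fun i => ∫ x, |F i x - f x| ∂μ) l (𝓝 0) := by
  have hmin : Tendsto (fun i => ∫ x, min (F i x) (f x) ∂μ) l (𝓝 (∫ x, f x ∂μ)) := by
    refine tendsto_integral_filter_of_dominated_convergence f ?_ ?_ hf ?_
    · filter_upwards [hF] with i hi using (hi.inf hf).aestronglyMeasurable
    · filter_upwards [hF_nonneg] with i hi
      filter_upwards [hi, hf_nonneg] with x hx hfx
      rw [Real.norm_of_nonneg (le_min hx hfx)]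
      exact min_le_right _ _
    · filter_upwards [hlim] with x hx
      simpa using hx.min (tendsto_const_nhds (x := f x))
  have hsum : Tendsto
      (fun i => (∫ x, F i x ∂μ) + (∫ x, f x ∂μ) - 2 * ∫ x, min (F i x) (f x) ∂μ) l (𝓝 0) := by
    convert (hint.add_const (∫ x, f x ∂μ)).sub (hmin.const_mul 2) using 2
    ring
  refine hsum.congr' ?_
  filter_upwards [hF] with i hi
  have hm : Integrable (fun x => min (F i x) (f x)) μ := hi.inf hf
  have hadd : Integrable (fun x => F i x + f x) μ := hi.add hf
  rw [← integral_add hi hf, ← integral_const_mul, ← integral_sub hadd (hm.const_mul 2)]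
  refine integral_congr_ae (Eventually.of_forall fun x => ?_)
  rcases le_total (F i x) (f x) with h | h
  · simp only [min_eq_left h, abs_of_nonpos (sub_nonpos.2 h)]
    ring
  · simp only [min_eq_right h, abs_of_nonneg (sub_nonneg.2 h)]
    ring

/-- Convergence in `L¹` implies convergence of the integrals against a bounded function. -/
theorem tendsto_integral_mul_of_tendsto_integral_abs_sub {ι X : Type*} [MeasurableSpace X]
    {μ : Measure X} {l : Filter ι} {F : ι → X → ℝ} {f φ : X → ℝ} {M : ℝ}
    (hF : ∀ᶠ i in l, Integrable (F i) μ) (hf : Integrable f μ)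
    (hφ : AEStronglyMeasurable φ μ) (hφ_bdd : ∀ x, |φ x| ≤ M)
    (h : Tendsto (fun i => ∫ x, |F i x - f x| ∂μ) l (𝓝 0)) :
    Tendsto (fun i => ∫ x, φ x * F i x ∂μ) l (𝓝 (∫ x, φ x * f x ∂μ)) := by
  have hbdd : ∀ᵐ x ∂μ, ‖φ x‖ ≤ M := Eventually.of_forall hφ_bdd
  rw [tendsto_iff_norm_sub_tendsto_zero]
  refine squeeze_zero' (Eventually.of_forall fun _ => norm_nonneg _) ?_
    (by simpa using h.const_mul M)
  filter_upwards [hF] with i hi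
  rw [← integral_sub (hi.bdd_mul hφ hbdd) (hf.bdd_mul hφ hbdd), ← integral_const_mul]
  refine norm_integral_le_of_norm_le ((hi.sub hf).abs.const_mul M)
    (Eventually.of_forall fun x => ?_)
  rw [← mul_sub, norm_mul]
  exact mul_le_mul_of_nonneg_right (hφ_bdd x) (abs_nonneg _)

/-- Lemma 5.2 (continuity in time of the law of a CTRW limit), abstract form:
if `g` is a continuous nonnegative function such that the self-similar family
`h(y,t) = (t/α) y^(−1−1/α) g(t y^(−1/α))` is a probability density in `y` for every `t > 0`,
then for every bounded measurable `φ` the map `t ↦ ∫₀^∞ φ(y) h(y,t) dy` is continuous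
on `(0,∞)`. -/
theorem stmt_6 (α : ℝ) (hα0 : 0 < α) (hα1 : α < 1)
    (g : ℝ → ℝ) (hg_cont : Continuous g) (hg_nonneg : ∀ x, 0 ≤ g x)
    (hdens : ∀ t : ℝ, 0 < t →
      ∫ y in Set.Ioi (0:ℝ), (t / α) * y ^ (-1 - 1/α) * g (t * y ^ (-(1/α))) = 1)
    (φ : ℝ → ℝ) (hφ_meas : Measurable φ) (M : ℝ) (hφ_bdd : ∀ x, |φ x| ≤ M) :
    ContinuousOn
      (fun t : ℝ => ∫ y in Set.Ioi (0:ℝ), φ y * ((t / α) * y ^ (-1 - 1/α) * g (t * y ^ (-(1/α)))))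
      (Set.Ioi 0) := by
  intro t ht
  have hint : ∀ s : ℝ, 0 < s → IntegrableOn
      (fun y : ℝ => (s / α) * y ^ (-1 - 1/α) * g (s * y ^ (-(1/α)))) (Ioi 0) :=
    fun s hs => integrable_of_integral_eq_one (hdens s hs)
  have hnonneg : ∀ s : ℝ, 0 < s → 0 ≤ᵐ[volume.restrict (Ioi 0)]
      (fun y : ℝ => (s / α) * y ^ (-1 - 1/α) * g (s * y ^ (-(1/α)))) := fun s hs => by
    filter_upwards [ae_restrict_mem measurableSet_Ioi] with y hy
    exact mul_nonneg (mul_nonneg (div_pos hs hα0).le (rpow_nonneg (mem_Ioi.1 hy).le _))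
      (hg_nonneg _)
  have hpos : ∀ᶠ s in 𝓝[Ioi 0] t, (0 : ℝ) < s := eventually_mem_nhdsWithin
  refine tendsto_integral_mul_of_tendsto_integral_abs_sub (hpos.mono hint) (hint t ht)
    hφ_meas.aestronglyMeasurable hφ_bdd ?_
  refine tendsto_integral_abs_sub_of_tendsto_integral (hpos.mono hint) (hpos.mono hnonneg)
    (hint t ht) (hnonneg t ht) (Eventually.of_forall fun y => ?_) ?_
  · have hcont : Continuous
        (fun s : ℝ => (s / α) * y ^ (-1 - 1/α) * g (s * y ^ (-(1/α)))) := by fun_prop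
    exact hcont.continuousWithinAt
  · rw [hdens t ht]
    exact tendsto_const_nhds.congr' (hpos.mono fun s hs => (hdens s hs).symm)
end

section
/- Let 0 < α < 1, t₀ > 0 and s > 0. Then ∫₀^∞ e^(−s·r) · p_{t₀}(r) dr = e^(s·t₀) · Γ(α, s·t₀) / Γ(α), where Γ(α, x) = ∫ₓ^∞ u^(α−1) e^(−u) du is the upper incomplete Gamma function. -/
open Real MeasureTheory

/-- The upper incomplete Gamma function `Γ(a, x) = ∫ₓ^∞ u^(a−1) e^(−u) du`. -/
noncomputable def upperGamma (a x : ℝ) : ℝ :=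
  ∫ u in Set.Ioi x, u ^ (a - 1) * Real.exp (-u)

theorem integrableOn_rpow_mul_exp_neg_mul {a b : ℝ} (ha : -1 < a) (hb : 0 < b) :
    IntegrableOn (fun x : ℝ => x ^ a * Real.exp (-(b * x))) (Set.Ioi 0) := by
  simpa [Real.rpow_one] using
    integrableOn_rpow_mul_exp_neg_mul_rpow (p := 1) ha one_pos hb

theorem integral_rpow_neg_mul_exp_neg_mul_add {α v : ℝ} (hα : α < 1) (hv : 0 < v) (h : ℝ) :
    ∫ r in Set.Ioi (0:ℝ), r ^ (-α) * Real.exp (-(v * (r + h)))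
      = Real.Gamma (1 - α) * (v ^ (α - 1) * Real.exp (-(h * v))) := by
  have key : ∀ r : ℝ, r ^ (-α) * Real.exp (-(v * (r + h)))
      = Real.exp (-(h * v)) * (r ^ ((1 - α) - 1) * Real.exp (-(v * r))) := by
    intro r
    rw [show -(v * (r + h)) = -(h * v) + -(v * r) by ring, Real.exp_add,
      show (1 - α) - 1 = -α by ring]
    ring
  simp_rw [key]
  rw [integral_const_mul, Real.integral_rpow_mul_exp_neg_mul_Ioi (by linarith) hv, one_div,
    Real.inv_rpow hv.le, ← Real.rpow_neg hv.le, neg_sub]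
  ring

theorem integral_exp_neg_mul_Ioi_of_pos {c : ℝ} (hc : 0 < c) (s : ℝ) :
    ∫ v in Set.Ioi s, Real.exp (-(v * c)) = Real.exp (-(s * c)) / c := by
  have := integral_exp_mul_Ioi (neg_lt_zero.mpr hc) s
  simpa [mul_comm] using this

theorem integrable_rpow_neg_mul_exp_neg_mul_add {α h s : ℝ} (hα0 : 0 < α) (hα1 : α < 1)
    (hh : 0 < h) (hs : 0 < s) :
    Integrable (Function.uncurry fun r v : ℝ => r ^ (-α) * Real.exp (-(v * (r + h))))
      ((volume.restrict (Set.Ioi 0)).prod (volume.restrict (Set.Ioi s))) := by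
  have hmeas : Measurable
      (Function.uncurry fun r v : ℝ => r ^ (-α) * Real.exp (-(v * (r + h)))) := by
    unfold Function.uncurry
    fun_prop
  rw [integrable_prod_iff' hmeas.aestronglyMeasurable]
  refine ⟨(ae_restrict_mem measurableSet_Ioi).mono fun v hv => ?_, ?_⟩
  · have hv' : 0 < v := hs.trans hv
    refine ((integrableOn_rpow_mul_exp_neg_mul (a := -α) (by linarith) hv').const_mul
      (Real.exp (-(v * h)))).congr (ae_of_all _ fun r => ?_)
    simp only [Function.uncurry_apply_pair]
    rw [mul_add, neg_add, Real.exp_add]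
    ring
  · have hint : IntegrableOn (fun v : ℝ => Real.Gamma (1 - α) *
        (v ^ (α - 1) * Real.exp (-(h * v)))) (Set.Ioi s) :=
      ((integrableOn_rpow_mul_exp_neg_mul (by linarith) hh).mono_set
        (Set.Ioi_subset_Ioi hs.le)).const_mul _
    refine hint.congr_fun (fun v hv => ?_) measurableSet_Ioi
    dsimp only
    rw [← integral_rpow_neg_mul_exp_neg_mul_add hα1 (hs.trans hv) h]
    refine setIntegral_congr_fun measurableSet_Ioi fun r hr => ?_
    have hr' : (0:ℝ) < r := hr
    simp only [Function.uncurry_apply_pair]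
    rw [Real.norm_of_nonneg (by positivity)]

theorem upperGamma_mul (α s : ℝ) {h : ℝ} (hs : 0 < s) (hh : 0 < h) :
    upperGamma α (s * h)
      = h ^ α * ∫ v in Set.Ioi s, v ^ (α - 1) * Real.exp (-(h * v)) := by
  rw [upperGamma, mul_comm s h,
    ← integral_comp_mul_left_Ioi' (fun u => u ^ (α - 1) * Real.exp (-u)) s hh, smul_eq_mul,
    ← integral_const_mul, ← integral_const_mul]
  refine setIntegral_congr_fun measurableSet_Ioi fun v hv => ?_
  have hv' : 0 < v := hs.trans hv
  rw [Real.mul_rpow hh.le hv'.le, Real.rpow_sub_one hh.ne']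
  field_simp

theorem exp_neg_mul_gb2_eq {α h r : ℝ} (s : ℝ) (hh : 0 < h) (hr : 0 < r) :
    Real.exp (-(s * r)) * gb2 α h r
      = h ^ α * Real.exp (s * h) / betaFn α (1 - α) *
        ∫ v in Set.Ioi s, r ^ (-α) * Real.exp (-(v * (r + h))) := by
  have hrh : 0 < r + h := add_pos hr hh
  rw [integral_const_mul, integral_exp_neg_mul_Ioi_of_pos hrh, gb2,
    Real.div_rpow hr.le hh.le, Real.rpow_neg hh.le, Real.rpow_neg_one,
    show -(s * (r + h)) = -(s * r) + -(s * h) by ring, Real.exp_add, Real.exp_neg (s * h),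
    show 1 + r / h = (r + h) / h by field_simp; ring]
  have := Real.exp_ne_zero (s * h)
  have := (Real.rpow_pos_of_pos hh α).ne'
  field_simp

/-- Equations (5.4)–(5.5): the Laplace transform of the generalized beta prime density is
`p̂_{t₀}(s) = e^(st₀) Γ(α, st₀) / Γ(α)`. -/
theorem stmt_7 (α t₀ s : ℝ) (hα0 : 0 < α) (hα1 : α < 1) (ht₀ : 0 < t₀) (hs : 0 < s) :
    ∫ r in Set.Ioi (0:ℝ), Real.exp (-(s * r)) * gb2 α t₀ r
      = Real.exp (s * t₀) * upperGamma α (s * t₀) / Real.Gamma α := by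
  have hΓ : Real.Gamma (1 - α) ≠ 0 := (Real.Gamma_pos_of_pos (sub_pos.mpr hα1)).ne'
  rw [setIntegral_congr_fun measurableSet_Ioi fun r hr => exp_neg_mul_gb2_eq s ht₀ hr,
    integral_const_mul,
    integral_integral_swap (integrable_rpow_neg_mul_exp_neg_mul_add hα0 hα1 ht₀ hs),
    setIntegral_congr_fun measurableSet_Ioi fun v hv =>
      integral_rpow_neg_mul_exp_neg_mul_add hα1 (hs.trans hv) t₀,
    integral_const_mul, upperGamma_mul α s hs ht₀, betaFn, add_sub_cancel, Real.Gamma_one]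
  field_simp
end

section
/- Let t₀ > 0 be fixed and let f : [0, ∞) → ℝ be a bounded continuous function. Then lim_{α→1⁻} ∫₀^∞ f(r) · (sin(πα)/π) · (r/t₀)^(−α) · (1 + r/t₀)^(−1) / t₀ dr = f(0); that is, the generalized beta prime distributions GB2(1−α, α, t₀) converge weakly to the Dirac measure at 0 as α → 1. -/
open Real MeasureTheory Filter Topology

/-- The substitution `r = t₀ * u ^ (1 - α)⁻¹` turns the density of `GB2(1 - α, α, t₀)` into
a multiple of `u ↦ (1 + u ^ (1 - α)⁻¹)⁻¹`. -/
lemma integral_mul_betaPrime_eq (f : ℝ → ℝ) {t₀ α : ℝ} (c : ℝ) (ht₀ : 0 < t₀) (hα : α < 1) :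
    ∫ r in Set.Ioi (0:ℝ), f r * c * ((r / t₀) ^ (-α) * (1 + r / t₀) ^ (-1 : ℝ) / t₀) =
      c / (1 - α) * ∫ u in Set.Ioi (0:ℝ),
        f (t₀ * u ^ (1 - α)⁻¹) * (1 + u ^ (1 - α)⁻¹)⁻¹ := by
  have hε : 0 < 1 - α := sub_pos.2 hα
  set G : ℝ → ℝ := fun r => f r * c * ((r / t₀) ^ (-α) * (1 + r / t₀) ^ (-1 : ℝ) / t₀) with hG
  have hscale := integral_comp_mul_left_Ioi G 0 ht₀
  rw [mul_zero, smul_eq_mul] at hscale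
  have hpow := integral_comp_rpow_Ioi (fun x => G (t₀ * x)) (inv_pos.2 hε).ne'
  have hmain : ∫ r in Set.Ioi (0:ℝ), G r = t₀ * ∫ x in Set.Ioi (0:ℝ), G (t₀ * x) := by
    rw [hscale]; field_simp
  rw [hmain, ← hpow, ← integral_const_mul, ← integral_const_mul]
  refine setIntegral_congr_fun measurableSet_Ioi fun u hu => ?_
  have hu : 0 < u := hu
  have hcancel : u ^ ((1 - α)⁻¹ - 1) * (u ^ (1 - α)⁻¹) ^ (-α) = 1 := by
    rw [← rpow_mul hu.le, ← rpow_add hu]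
    have : (1 - α)⁻¹ - 1 + (1 - α)⁻¹ * -α = 0 := by field_simp; ring
    rw [this, rpow_zero]
  have hdiv : t₀ * u ^ (1 - α)⁻¹ / t₀ = u ^ (1 - α)⁻¹ := by field_simp
  simp only [hG, smul_eq_mul, hdiv, rpow_neg_one, abs_of_pos (inv_pos.2 hε)]
  calc _ = c / (1 - α) * (f (t₀ * u ^ (1 - α)⁻¹) * (1 + u ^ (1 - α)⁻¹)⁻¹) *
        (u ^ ((1 - α)⁻¹ - 1) * (u ^ (1 - α)⁻¹) ^ (-α)) * (t₀ / t₀) := by ring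
    _ = _ := by rw [hcancel, div_self ht₀.ne', mul_one, mul_one]

lemma inv_one_add_rpow_le {u p : ℝ} (hu : 0 < u) (hp : 2 ≤ p) :
    (1 + u ^ p)⁻¹ ≤ 2 * (1 + u ^ 2)⁻¹ := by
  have hup : 0 < u ^ p := rpow_pos_of_pos hu p
  rw [← div_eq_mul_inv, inv_eq_one_div, div_le_div_iff₀ (by positivity) (by positivity)]
  rcases le_total u 1 with h | h
  · nlinarith
  · have h2 : u ^ (2:ℝ) ≤ u ^ p := rpow_le_rpow_of_exponent_le h hp
    rw [rpow_two] at h2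
    nlinarith

lemma tendsto_integral_comp_rpow_mul_inv_one_add_rpow {t₀ : ℝ} (ht₀ : 0 < t₀) {f : ℝ → ℝ}
    (hf_cont : ContinuousOn f (Set.Ici 0)) {M : ℝ} (hf_bdd : ∀ x, |f x| ≤ M) :
    Tendsto (fun p : ℝ => ∫ u in Set.Ioi (0:ℝ), f (t₀ * u ^ p) * (1 + u ^ p)⁻¹)
      atTop (𝓝 (f 0)) := by
  have hlim : ∫ u in Set.Ioi (0:ℝ), (Set.Ioc (0:ℝ) 1).indicator (fun _ => f 0) u = f 0 := by
    rw [setIntegral_indicator measurableSet_Ioc,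
      Set.inter_eq_self_of_subset_right Set.Ioc_subset_Ioi_self]
    simp
  rw [← hlim]
  refine tendsto_integral_filter_of_dominated_convergence
    (fun u => M * (2 * (1 + u ^ 2)⁻¹)) ?_ ?_ ?_ ?_
  · refine .of_forall fun p => ContinuousOn.aestronglyMeasurable ?_ measurableSet_Ioi
    have hpow : ContinuousOn (fun u : ℝ => u ^ p) (Set.Ioi 0) := fun u hu =>
      (continuousAt_rpow_const u p (Or.inl (ne_of_gt hu))).continuousWithinAt
    refine ContinuousOn.mul (hf_cont.comp (continuousOn_const.mul hpow) fun u hu => ?_)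
      ((continuousOn_const.add hpow).inv₀ fun u hu => ?_)
    · exact mul_nonneg ht₀.le (rpow_nonneg (le_of_lt hu) p)
    · exact (add_pos one_pos (rpow_pos_of_pos hu p)).ne'
  · filter_upwards [eventually_ge_atTop 2] with p hp
    filter_upwards [ae_restrict_mem measurableSet_Ioi] with u hu
    have hpos : 0 < u ^ p := rpow_pos_of_pos hu p
    rw [norm_mul, norm_eq_abs, norm_of_nonneg (by positivity : 0 ≤ (1 + u ^ p)⁻¹)]
    exact mul_le_mul (hf_bdd _) (inv_one_add_rpow_le hu hp) (by positivity)
      ((abs_nonneg _).trans (hf_bdd 0))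
  · exact ((integrable_inv_one_add_sq.const_mul 2).const_mul M).integrableOn
  · filter_upwards [ae_restrict_mem measurableSet_Ioi,
      ae_restrict_of_ae (Measure.ae_ne volume (1:ℝ))] with u hu hu1
    have hu : 0 < u := hu
    rcases lt_or_gt_of_ne hu1 with h | h
    · have hpow : Tendsto (fun p : ℝ => u ^ p) atTop (𝓝 0) :=
        tendsto_rpow_atTop_of_base_lt_one u (by linarith) h
      have hfpow : Tendsto (fun p : ℝ => f (t₀ * u ^ p)) atTop (𝓝 (f 0)) := by
        refine (hf_cont 0 Set.self_mem_Ici).tendsto.comp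
          (tendsto_nhdsWithin_iff.2 ⟨by simpa using hpow.const_mul t₀, .of_forall fun p => ?_⟩)
        exact mul_nonneg ht₀.le (rpow_nonneg hu.le p)
      rw [Set.indicator_of_mem (show u ∈ Set.Ioc (0:ℝ) 1 from ⟨hu, h.le⟩)]
      simpa using hfpow.mul ((hpow.const_add 1).inv₀ (by norm_num))
    · rw [Set.indicator_of_notMem fun hmem => absurd hmem.2 (not_le.2 h)]
      have hpow : Tendsto (fun p : ℝ => (1 + u ^ p)⁻¹) atTop (𝓝 0) :=
        (tendsto_atTop_add_const_left _ _
          (tendsto_rpow_atTop_of_base_gt_one u h)).inv_tendsto_atTop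
      exact bdd_le_mul_tendsto_zero' M (.of_forall fun p => hf_bdd _) hpow

lemma tendsto_sin_pi_mul_div_one_sub :
    Tendsto (fun α : ℝ => sin (π * α) / π / (1 - α)) (𝓝[<] (1:ℝ)) (𝓝 1) := by
  have h : HasDerivAt (fun α : ℝ => sin (π * α) / π) (-1) 1 := by
    have := (((hasDerivAt_id (1:ℝ)).const_mul π).sin).div_const π
    simpa [pi_ne_zero] using this
  have hslope := (hasDerivAt_iff_tendsto_slope.1 h).mono_left
    (nhdsWithin_mono (1:ℝ) fun x (hx : x ∈ Set.Iio 1) => ne_of_lt hx)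
  refine (by simpa using hslope.neg : Tendsto _ _ (𝓝 (1:ℝ))).congr fun α => ?_
  rw [slope_def_field, ← div_neg, neg_sub]
  simp

/-- Proposition 5.4 (weak convergence of `GB2(1−α, α, t₀)` to `δ₀` as `α → 1⁻`):
for every bounded continuous `f` on `[0,∞)`,
`∫₀^∞ f(r) (sin(πα)/π) (r/t₀)^(−α) (1 + r/t₀)^(−1) / t₀ dr → f(0)` as `α → 1⁻`. -/
theorem stmt_9 (t₀ : ℝ) (ht₀ : 0 < t₀)
    (f : ℝ → ℝ) (hf_cont : ContinuousOn f (Set.Ici 0)) (M : ℝ) (hf_bdd : ∀ x, |f x| ≤ M) :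
    Tendsto
      (fun α : ℝ => ∫ r in Set.Ioi (0:ℝ),
        f r * (Real.sin (Real.pi * α) / Real.pi)
          * ((r / t₀) ^ (-α) * (1 + r / t₀) ^ (-1 : ℝ) / t₀))
      (𝓝[<] (1:ℝ)) (𝓝 (f 0)) := by
  have hp : Tendsto (fun α : ℝ => (1 - α)⁻¹) (𝓝[<] (1:ℝ)) atTop := by
    refine tendsto_inv_nhdsGT_zero.comp (tendsto_nhdsWithin_iff.2 ⟨?_, ?_⟩)
    · have : Tendsto (fun α : ℝ => 1 - α) (𝓝 1) (𝓝 (1 - 1)) :=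
        (continuous_const.sub continuous_id).tendsto 1
      rw [sub_self] at this
      exact this.mono_left nhdsWithin_le_nhds
    · filter_upwards [self_mem_nhdsWithin] with α hα using sub_pos.2 (Set.mem_Iio.1 hα)
  have hmain := tendsto_sin_pi_mul_div_one_sub.mul
    ((tendsto_integral_comp_rpow_mul_inv_one_add_rpow ht₀ hf_cont hf_bdd).comp hp)
  rw [one_mul] at hmain
  refine hmain.congr' ?_
  filter_upwards [self_mem_nhdsWithin] with α hα
  exact (integral_mul_betaPrime_eq f _ ht₀ hα).symm
end

section
/- Let 0 < α < 1 and s > 0 be fixed. Then lim_{t₀→∞} (s·t₀)^(1−α) · ∫₀^∞ e^(−s·r) · p_{t₀}(r) dr = 1/Γ(α); that is, the Laplace transform p̂_{t₀}(s) of the generalized beta prime density satisfies p̂_{t₀}(s) ~ (s·t₀)^(α−1)/Γ(α) as t₀ → ∞. In particular p̂_{t₀}(s) → 0 as t₀ → ∞. -/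
open Real MeasureTheory Filter Topology

theorem integrableOn_rpow_mul_exp_neg_mul_Ioi {a s : ℝ} (ha : 0 < a) (hs : 0 < s) :
    IntegrableOn (fun r : ℝ => r ^ (a - 1) * Real.exp (-(s * r))) (Set.Ioi 0) := by
  by_contra h
  have h0 := integral_undef h
  rw [Real.integral_rpow_mul_exp_neg_mul_Ioi ha hs] at h0
  have := Real.Gamma_pos_of_pos ha
  exact absurd h0 (by positivity)

theorem tendsto_integral_rpow_mul_exp_neg_mul_mul_inv_one_add_div {a s : ℝ}
    (ha : 0 < a) (hs : 0 < s) :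
    Tendsto (fun t : ℝ => ∫ r in Set.Ioi (0 : ℝ),
        r ^ (a - 1) * Real.exp (-(s * r)) * (1 + r / t)⁻¹)
      atTop (𝓝 ((1 / s) ^ a * Real.Gamma a)) := by
  rw [← Real.integral_rpow_mul_exp_neg_mul_Ioi ha hs]
  refine tendsto_integral_filter_of_dominated_convergence _ (.of_forall fun t => ?_) ?_
    (integrableOn_rpow_mul_exp_neg_mul_Ioi ha hs) (ae_of_all _ fun r => ?_)
  · exact Measurable.aestronglyMeasurable (by fun_prop)
  · filter_upwards [eventually_gt_atTop 0] with t ht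
    filter_upwards [ae_restrict_mem measurableSet_Ioi] with r hr
    have hr : 0 < r := hr
    rw [Real.norm_of_nonneg (by positivity)]
    refine mul_le_of_le_one_right (by positivity) (inv_le_one_of_one_le₀ ?_)
    have : 0 < r / t := by positivity
    linarith
  · have h : Tendsto (fun t : ℝ => (1 + r / t)⁻¹) atTop (𝓝 (1 + 0)⁻¹) :=
      ((tendsto_id.const_div_atTop r).const_add 1).inv₀ (by norm_num)
    simpa using h.const_mul (r ^ (a - 1) * Real.exp (-(s * r)))

theorem rpow_mul_integral_exp_neg_mul_gb2 (α s : ℝ) (hs : 0 < s) {t : ℝ} (ht : 0 < t) :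
    (s * t) ^ (1 - α) * ∫ r in Set.Ioi (0 : ℝ), Real.exp (-(s * r)) * gb2 α t r =
      s ^ (1 - α) / (Real.Gamma α * Real.Gamma (1 - α)) * ∫ r in Set.Ioi (0 : ℝ),
        r ^ (1 - α - 1) * Real.exp (-(s * r)) * (1 + r / t)⁻¹ := by
  rw [← integral_const_mul, ← integral_const_mul]
  refine setIntegral_congr_fun measurableSet_Ioi fun r hr => ?_
  have hr : 0 < r := hr
  have h_beta : betaFn α (1 - α) = Real.Gamma α * Real.Gamma (1 - α) := by
    simp [betaFn]
  have h_pow : t ^ (1 - α) * t ^ α = t := by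
    rw [← Real.rpow_add ht]
    simp
  have h_exp : 1 - α - 1 = -α := by ring
  simp only [gb2, h_beta, h_exp]
  rw [Real.mul_rpow hs.le ht.le, Real.div_rpow hr.le ht.le, Real.rpow_neg ht.le,
    Real.rpow_neg_one, div_inv_eq_mul]
  calc
    _ = t ^ (1 - α) * t ^ α / t * (s ^ (1 - α) / (Real.Gamma α * Real.Gamma (1 - α)) *
        (r ^ (-α) * Real.exp (-(s * r)) * (1 + r / t)⁻¹)) := by
      rw [div_mul_eq_div_div]
      ring
    _ = _ := by rw [h_pow, div_self ht.ne', one_mul]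

/-- Equation (5.6): the Laplace transform `p̂_{t₀}(s)` of the generalized beta prime density
satisfies `(s t₀)^(1−α) p̂_{t₀}(s) → 1/Γ(α)` as `t₀ → ∞`, i.e.
`p̂_{t₀}(s) ∼ (s t₀)^(α−1)/Γ(α)`; in particular `p̂_{t₀}(s) → 0` as `t₀ → ∞`. -/
theorem stmt_11 (α s : ℝ) (hα0 : 0 < α) (hα1 : α < 1) (hs : 0 < s) :
    Tendsto
        (fun t₀ : ℝ => (s * t₀) ^ (1 - α) * ∫ r in Set.Ioi (0:ℝ), Real.exp (-(s * r)) * gb2 α t₀ r)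
        atTop (𝓝 (1 / Real.Gamma α))
      ∧ Tendsto (fun t₀ : ℝ => ∫ r in Set.Ioi (0:ℝ), Real.exp (-(s * r)) * gb2 α t₀ r)
          atTop (𝓝 0) := by
  have ha : 0 < 1 - α := sub_pos.2 hα1
  have h_lim : Tendsto
      (fun t₀ : ℝ => (s * t₀) ^ (1 - α) * ∫ r in Set.Ioi (0:ℝ), Real.exp (-(s * r)) * gb2 α t₀ r)
      atTop (𝓝 (1 / Real.Gamma α)) := by
    have h_const : s ^ (1 - α) / (Real.Gamma α * Real.Gamma (1 - α)) *
        ((1 / s) ^ (1 - α) * Real.Gamma (1 - α)) = 1 / Real.Gamma α := by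
      have := Real.Gamma_pos_of_pos hα0
      have := Real.Gamma_pos_of_pos ha
      have := Real.rpow_pos_of_pos hs (1 - α)
      rw [one_div s, Real.inv_rpow hs.le]
      field_simp
    rw [← h_const]
    refine ((tendsto_integral_rpow_mul_exp_neg_mul_mul_inv_one_add_div ha hs).const_mul
      _).congr' ?_
    filter_upwards [eventually_gt_atTop 0] with t ht
    exact (rpow_mul_integral_exp_neg_mul_gb2 α s hs ht).symm
  refine ⟨h_lim, ?_⟩
  have h_top : Tendsto (fun t : ℝ => (s * t) ^ (1 - α)) atTop atTop :=
    (tendsto_rpow_atTop ha).comp (tendsto_id.const_mul_atTop hs)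
  refine (h_lim.div_atTop h_top).congr' ?_
  filter_upwards [eventually_gt_atTop 0] with t ht
  exact mul_div_cancel_left₀ _ (by positivity)
end
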